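/- Let X ⊆ ℂⁿ be open. Assume: (i) every d-closed smooth (1,1)-form on X with compact support equals dh for some smooth 1-form h on X with compact support; (ii) every ∂̄-closed smooth (0,1)-form on X with compact support equals ∂̄g for some smooth function g on X with compact support; (iii) every ∂-closed smooth (1,0)-form on X with compact support equals ∂g for some smooth function g on X with compact support. Then every d-closed smooth (1,1)-form T on X with compact support can be written T = ∂∂̄S, i.e. T_{jk} = ∂²S/∂z_j∂z̄_k for all j,k, for some smooth function S on X with compact support. -/

import Mathlib

open Complex

noncomputable section

/-- Wirtinger derivative `∂u/∂z_j` of `u` within the set `X`, at `z`. -/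
def wdz {n : ℕ} (X : Set (Fin n → ℂ)) (u : (Fin n → ℂ) → ℂ) (j : Fin n)
    (z : Fin n → ℂ) : ℂ :=
  (1 / 2 : ℂ) * (fderivWithin ℝ u X z (Pi.single j 1) -
    Complex.I * fderivWithin ℝ u X z (Pi.single j Complex.I))

/-- Wirtinger derivative `∂u/∂z̄_j` of `u` within the set `X`, at `z`. -/
def wdzbar {n : ℕ} (X : Set (Fin n → ℂ)) (u : (Fin n → ℂ) → ℂ) (j : Fin n)
    (z : Fin n → ℂ) : ℂ :=
  (1 / 2 : ℂ) * (fderivWithin ℝ u X z (Pi.single j 1) +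
    Complex.I * fderivWithin ℝ u X z (Pi.single j Complex.I))

/-- `∂²u/∂z_j∂z̄_k` within `X`. -/
def ddbar {n : ℕ} (X : Set (Fin n → ℂ)) (u : (Fin n → ℂ) → ℂ) (j k : Fin n)
    (z : Fin n → ℂ) : ℂ :=
  wdz X (wdzbar X u k) j z

/-- The support of `u` as a function on `X`: the closure in `X` of its nonvanishing set. -/
def suppIn {n : ℕ} (X : Set (Fin n → ℂ)) (u : (Fin n → ℂ) → ℂ) : Set (Fin n → ℂ) :=
  X ∩ closure {z | z ∈ X ∧ u z ≠ 0}

/-- Support of a (1,1)-form given by its coefficient matrix. -/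
def supp11 {n : ℕ} (X : Set (Fin n → ℂ)) (T : Fin n → Fin n → (Fin n → ℂ) → ℂ) :
    Set (Fin n → ℂ) :=
  ⋃ j, ⋃ k, suppIn X (T j k)

/-- Support of a 1-form `Σ a_j dz_j + Σ b_k dz̄_k`. -/
def supp1 {n : ℕ} (X : Set (Fin n → ℂ)) (a b : Fin n → (Fin n → ℂ) → ℂ) :
    Set (Fin n → ℂ) :=
  (⋃ j, suppIn X (a j)) ∪ (⋃ k, suppIn X (b k))

/-- Smoothness of the coefficients of a (1,1)-form on `X`. -/
def Smooth11 {n : ℕ} (X : Set (Fin n → ℂ)) (f : Fin n → Fin n → (Fin n → ℂ) → ℂ) : Prop :=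
  ∀ j k, ContDiffOn ℝ (⊤ : ℕ∞) (f j k) X

/-- A (1,1)-form `Σ f_{jk} dz_j ∧ dz̄_k` is d-closed. -/
def DClosed11 {n : ℕ} (X : Set (Fin n → ℂ)) (f : Fin n → Fin n → (Fin n → ℂ) → ℂ) : Prop :=
  ∀ j k l, ∀ z ∈ X,
    wdz X (f j k) l z = wdz X (f l k) j z ∧ wdzbar X (f j k) l z = wdzbar X (f j l) k z

/-- `d(Σ a_j dz_j + Σ b_k dz̄_k) = f` for a (1,1)-form `f`. -/
def IsDOf {n : ℕ} (X : Set (Fin n → ℂ)) (a b : Fin n → (Fin n → ℂ) → ℂ)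
    (f : Fin n → Fin n → (Fin n → ℂ) → ℂ) : Prop :=
  (∀ j k, ∀ z ∈ X, f j k z = wdz X (b k) j z - wdzbar X (a j) k z) ∧
  (∀ j l, ∀ z ∈ X, wdz X (a j) l z = wdz X (a l) j z) ∧
  (∀ k l, ∀ z ∈ X, wdzbar X (b k) l z = wdzbar X (b l) k z)

/-- A (0,1)-form `Σ b_k dz̄_k` is ∂̄-closed. -/
def DbarClosed01 {n : ℕ} (X : Set (Fin n → ℂ)) (b : Fin n → (Fin n → ℂ) → ℂ) : Prop :=
  ∀ k l, ∀ z ∈ X, wdzbar X (b k) l z = wdzbar X (b l) k z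

/-- A (1,0)-form `Σ a_j dz_j` is ∂-closed. -/
def DClosed10 {n : ℕ} (X : Set (Fin n → ℂ)) (a : Fin n → (Fin n → ℂ) → ℂ) : Prop :=
  ∀ j l, ∀ z ∈ X, wdz X (a j) l z = wdz X (a l) j z

theorem isCompact_suppIn_of_subset {n : ℕ} {X K : Set (Fin n → ℂ)} {u : (Fin n → ℂ) → ℂ}
    (hK : IsCompact K) (hKX : K ⊆ X) (h : suppIn X u ⊆ K) : IsCompact (suppIn X u) := by
  have : suppIn X u = K ∩ closure {z | z ∈ X ∧ u z ≠ 0} :=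
    Set.Subset.antisymm (fun z hz => ⟨h hz, hz.2⟩) (fun z hz => ⟨hKX hz.1, hz.2⟩)
  rw [this]
  exact hK.inter_right isClosed_closure

theorem suppIn_sub_subset {n : ℕ} (X : Set (Fin n → ℂ)) (u v : (Fin n → ℂ) → ℂ) :
    suppIn X (u - v) ⊆ suppIn X u ∪ suppIn X v := by
  rintro z ⟨hz, hc⟩
  have hsub : {z | z ∈ X ∧ (u - v) z ≠ 0} ⊆ {z | z ∈ X ∧ u z ≠ 0} ∪ {z | z ∈ X ∧ v z ≠ 0} := by
    rintro w ⟨hw, hne⟩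
    by_cases hu : u w = 0
    · exact Or.inr ⟨hw, fun hv => hne (by simp [hu, hv])⟩
    · exact Or.inl ⟨hw, hu⟩
  have := closure_mono hsub hc
  rw [closure_union] at this
  exact this.imp (fun h => ⟨hz, h⟩) (fun h => ⟨hz, h⟩)

theorem suppIn_subset {n : ℕ} (X : Set (Fin n → ℂ)) (u : (Fin n → ℂ) → ℂ) : suppIn X u ⊆ X :=
  Set.inter_subset_left

section SecondDerivatives

variable {n : ℕ} {X : Set (Fin n → ℂ)} {u v : (Fin n → ℂ) → ℂ} {z : Fin n → ℂ}

theorem hasFDerivWithinAt_fderivWithin_apply (hX : IsOpen X)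
    (hu : ContDiffOn ℝ (⊤ : ℕ∞) u X) (hz : z ∈ X) (e : Fin n → ℂ) :
    HasFDerivWithinAt (fun w => fderivWithin ℝ u X w e)
      ((fderivWithin ℝ (fderivWithin ℝ u X) X z).flip e) X z := by
  have hd : DifferentiableOn ℝ (fderivWithin ℝ u X) X :=
    (hu.fderivWithin hX.uniqueDiffOn (m := 1)
      (WithTop.coe_le_coe.2 (le_top : (1 + 1 : ℕ∞) ≤ ⊤))).differentiableOn
      one_ne_zero
  exact (hd z hz).hasFDerivWithinAt.clm_apply (hasFDerivWithinAt_const e z X) |>.congr_fderiv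
    (by ext; simp)

theorem fderivWithin_wdz_apply (hX : IsOpen X) (hu : ContDiffOn ℝ (⊤ : ℕ∞) u X) (hz : z ∈ X)
    (j : Fin n) (e : Fin n → ℂ) :
    fderivWithin ℝ (wdz X u j) X z e =
      (1 / 2 : ℂ) * (fderivWithin ℝ (fderivWithin ℝ u X) X z e (Pi.single j 1) -
        Complex.I * fderivWithin ℝ (fderivWithin ℝ u X) X z e (Pi.single j Complex.I)) := by
  have h := ((hasFDerivWithinAt_fderivWithin_apply hX hu hz (Pi.single j 1)).sub
    ((hasFDerivWithinAt_fderivWithin_apply hX hu hz (Pi.single j Complex.I)).const_mul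
      Complex.I)).const_mul (1 / 2 : ℂ)
  have h' : HasFDerivWithinAt (wdz X u j) _ X z := h
  rw [h'.fderivWithin (hX.uniqueDiffWithinAt hz)]
  simp

theorem hasFDerivWithinAt_wdzbar (hX : IsOpen X) (hu : ContDiffOn ℝ (⊤ : ℕ∞) u X) (hz : z ∈ X)
    (k : Fin n) :
    HasFDerivWithinAt (wdzbar X u k)
      ((1 / 2 : ℂ) • ((fderivWithin ℝ (fderivWithin ℝ u X) X z).flip (Pi.single k 1) +
        Complex.I • (fderivWithin ℝ (fderivWithin ℝ u X) X z).flip (Pi.single k Complex.I)))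
      X z :=
  ((hasFDerivWithinAt_fderivWithin_apply hX hu hz (Pi.single k 1)).add
    ((hasFDerivWithinAt_fderivWithin_apply hX hu hz (Pi.single k Complex.I)).const_mul
      Complex.I)).const_mul (1 / 2 : ℂ)

theorem fderivWithin_wdzbar_apply (hX : IsOpen X) (hu : ContDiffOn ℝ (⊤ : ℕ∞) u X) (hz : z ∈ X)
    (k : Fin n) (e : Fin n → ℂ) :
    fderivWithin ℝ (wdzbar X u k) X z e =
      (1 / 2 : ℂ) * (fderivWithin ℝ (fderivWithin ℝ u X) X z e (Pi.single k 1) +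
        Complex.I * fderivWithin ℝ (fderivWithin ℝ u X) X z e (Pi.single k Complex.I)) := by
  rw [(hasFDerivWithinAt_wdzbar hX hu hz k).fderivWithin (hX.uniqueDiffWithinAt hz)]
  simp [mul_add]

theorem wdzbar_wdz_eq_ddbar (hX : IsOpen X) (hu : ContDiffOn ℝ (⊤ : ℕ∞) u X) (hz : z ∈ X)
    (j k : Fin n) : wdzbar X (wdz X u j) k z = ddbar X u j k z := by
  have hs : IsSymmSndFDerivWithinAt ℝ u X z :=
    (hu z hz).isSymmSndFDerivWithinAt
      (by simpa using WithTop.coe_le_coe.2 (le_top : (2 : ℕ∞) ≤ ⊤)) hX.uniqueDiffOn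
      (subset_closure (by rwa [hX.interior_eq])) hz
  rw [ddbar, wdzbar, wdz]
  simp only [fderivWithin_wdz_apply hX hu hz, fderivWithin_wdzbar_apply hX hu hz]
  rw [hs.eq (Pi.single k 1) (Pi.single j 1), hs.eq (Pi.single k 1) (Pi.single j Complex.I),
    hs.eq (Pi.single k Complex.I) (Pi.single j 1),
    hs.eq (Pi.single k Complex.I) (Pi.single j Complex.I)]
  ring

theorem wdz_congr {j : Fin n} (h : Set.EqOn u v X) (hz : z ∈ X) : wdz X u j z = wdz X v j z := by
  rw [wdz, wdz, fderivWithin_congr h (h hz)]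

theorem wdzbar_congr {j : Fin n} (h : Set.EqOn u v X) (hz : z ∈ X) :
    wdzbar X u j z = wdzbar X v j z := by
  rw [wdzbar, wdzbar, fderivWithin_congr h (h hz)]

theorem wdz_sub (hX : IsOpen X) (hu : DifferentiableWithinAt ℝ u X z)
    (hv : DifferentiableWithinAt ℝ v X z) (hz : z ∈ X) (j : Fin n) :
    wdz X (u - v) j z = wdz X u j z - wdz X v j z := by
  simp only [wdz, fderivWithin_sub (hX.uniqueDiffWithinAt hz) hu hv,
    sub_apply]
  ring

theorem wdzbar_sub (hX : IsOpen X) (hu : DifferentiableWithinAt ℝ u X z)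
    (hv : DifferentiableWithinAt ℝ v X z) (hz : z ∈ X) (k : Fin n) :
    wdzbar X (u - v) k z = wdzbar X u k z - wdzbar X v k z := by
  simp only [wdzbar, fderivWithin_sub (hX.uniqueDiffWithinAt hz) hu hv,
    sub_apply]
  ring

theorem ddbar_sub (hX : IsOpen X) (hu : ContDiffOn ℝ (⊤ : ℕ∞) u X)
    (hv : ContDiffOn ℝ (⊤ : ℕ∞) v X) (hz : z ∈ X) (j k : Fin n) :
    ddbar X (u - v) j k z = ddbar X u j k z - ddbar X v j k z := by
  have h : Set.EqOn (wdzbar X (u - v) k) (wdzbar X u k - wdzbar X v k) X := fun w hw =>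
    wdzbar_sub hX (hu.differentiableOn (by simp) w hw) (hv.differentiableOn (by simp) w hw) hw k
  rw [ddbar, wdz_congr h hz]
  exact wdz_sub hX (hasFDerivWithinAt_wdzbar hX hu hz k).differentiableWithinAt
    (hasFDerivWithinAt_wdzbar hX hv hz k).differentiableWithinAt hz j

end SecondDerivatives

/-- Compactly supported version: if on `X` every compactly supported
d-closed smooth (1,1)-form is `dh` with `h` a compactly supported smooth 1-form, and the
analogous statements hold for ∂̄-closed (0,1)-forms and ∂-closed (1,0)-forms, then every
compactly supported d-closed smooth (1,1)-form `T` on `X` is `∂∂̄S` for some compactly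
supported smooth function `S` on `X`. -/
theorem stmt9 {n : ℕ} (hn : 0 < n) (X : Set (Fin n → ℂ)) (hX : IsOpen X)
    (hi : ∀ f : Fin n → Fin n → (Fin n → ℂ) → ℂ, Smooth11 X f → DClosed11 X f →
      IsCompact (supp11 X f) →
      ∃ a b : Fin n → (Fin n → ℂ) → ℂ,
        (∀ j, ContDiffOn ℝ (⊤ : ℕ∞) (a j) X) ∧ (∀ k, ContDiffOn ℝ (⊤ : ℕ∞) (b k) X) ∧
        IsDOf X a b f ∧ IsCompact (supp1 X a b))
    (hii : ∀ b : Fin n → (Fin n → ℂ) → ℂ, (∀ k, ContDiffOn ℝ (⊤ : ℕ∞) (b k) X) →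
      DbarClosed01 X b → IsCompact (⋃ k, suppIn X (b k)) →
      ∃ g : (Fin n → ℂ) → ℂ, ContDiffOn ℝ (⊤ : ℕ∞) g X ∧ IsCompact (suppIn X g) ∧
        ∀ k, ∀ z ∈ X, b k z = wdzbar X g k z)
    (hiii : ∀ a : Fin n → (Fin n → ℂ) → ℂ, (∀ j, ContDiffOn ℝ (⊤ : ℕ∞) (a j) X) →
      DClosed10 X a → IsCompact (⋃ j, suppIn X (a j)) →
      ∃ g : (Fin n → ℂ) → ℂ, ContDiffOn ℝ (⊤ : ℕ∞) g X ∧ IsCompact (suppIn X g) ∧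
        ∀ j, ∀ z ∈ X, a j z = wdz X g j z) :
    ∀ T : Fin n → Fin n → (Fin n → ℂ) → ℂ, Smooth11 X T → DClosed11 X T →
      IsCompact (supp11 X T) →
      ∃ S : (Fin n → ℂ) → ℂ, ContDiffOn ℝ (⊤ : ℕ∞) S X ∧ IsCompact (suppIn X S) ∧
        ∀ j k, ∀ z ∈ X, T j k z = ddbar X S j k z := by
  intro T hT hTc hTK
  obtain ⟨a, b, ha, hb, ⟨hab, haa, hbb⟩, hK⟩ := hi T hT hTc hTK
  have hKX : supp1 X a b ⊆ X :=
    Set.union_subset (Set.iUnion_subset fun j => suppIn_subset X (a j))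
      (Set.iUnion_subset fun k => suppIn_subset X (b k))
  have hKa : IsCompact (⋃ j, suppIn X (a j)) := isCompact_iUnion fun j =>
    isCompact_suppIn_of_subset hK hKX
      ((Set.subset_iUnion (fun j => suppIn X (a j)) j).trans Set.subset_union_left)
  have hKb : IsCompact (⋃ k, suppIn X (b k)) := isCompact_iUnion fun k =>
    isCompact_suppIn_of_subset hK hKX
      ((Set.subset_iUnion (fun k => suppIn X (b k)) k).trans Set.subset_union_right)
  obtain ⟨g, hg, hgK, hbg⟩ := hii b hb hbb hKb
  obtain ⟨f, hf, hfK, haf⟩ := hiii a ha haa hKa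
  refine ⟨g - f, hg.sub hf, isCompact_suppIn_of_subset (hgK.union hfK)
    (Set.union_subset (suppIn_subset X g) (suppIn_subset X f)) (suppIn_sub_subset X g f), ?_⟩
  intro j k z hz
  rw [hab j k z hz, ddbar_sub hX hg hf hz, wdz_congr (hbg k) hz, wdzbar_congr (haf j) hz,
    wdzbar_wdz_eq_ddbar hX hf hz]
  rfl
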